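/- If SOL^w(K_∞, f^∞) = {0}, then the Pareto efficient solution set SOL^s(K, f) is nonempty and the weak Pareto efficient solution set SOL^w(K, f) is compact. -/

import Mathlib

open Filter Topology MvPolynomial

/-- The asymptotic cone of a set `K ⊆ ℝⁿ`:
`K_∞ = {v : ∃ t_k → +∞, x_k ∈ K with x_k / t_k → v}`. -/
def asympCone {n : ℕ} (K : Set (Fin n → ℝ)) : Set (Fin n → ℝ) :=
  {v | ∃ (t : ℕ → ℝ) (x : ℕ → (Fin n → ℝ)), (∀ k, x k ∈ K) ∧
    Tendsto t atTop atTop ∧ Tendsto (fun k => (t k)⁻¹ • x k) atTop (nhds v)}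

/-- The weak Pareto efficient solution set of the vector function `p` on `C`:
`x* ∈ C` such that for no `x ∈ C` we have `p(x) - p(x*) ∈ -int ℝˢ₊`. -/
def SOLw {n s : ℕ} (C : Set (Fin n → ℝ)) (p : Fin s → (Fin n → ℝ) → ℝ) : Set (Fin n → ℝ) :=
  {x | x ∈ C ∧ ∀ y ∈ C, ¬ (∀ i, p i y < p i x)}

/-- The Pareto efficient solution set of the vector function `p` on `C`:
`x* ∈ C` such that for no `x ∈ C` we have `p(x) - p(x*) ∈ -ℝˢ₊ \ {0}`. -/
def SOLs {n s : ℕ} (C : Set (Fin n → ℝ)) (p : Fin s → (Fin n → ℝ) → ℝ) : Set (Fin n → ℝ) :=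
  {x | x ∈ C ∧ ∀ y ∈ C, ¬ ((∀ i, p i y ≤ p i x) ∧ (∃ i, p i y < p i x))}

/-- The set of global minimizers of the scalar function `q` on `C`. -/
def SOLmin {n : ℕ} (C : Set (Fin n → ℝ)) (q : (Fin n → ℝ) → ℝ) : Set (Fin n → ℝ) :=
  {x | x ∈ C ∧ ∀ y ∈ C, q x ≤ q y}

/-- The recession polynomial (vector leading term) of `p`, as a function:
`p^∞(x) = lim_{λ→+∞} p(λx)/λ^{deg p}`, i.e. the evaluation of the homogeneous
component of `p` of top degree. -/
noncomputable def recFn {n : ℕ} (p : MvPolynomial (Fin n) ℝ) : (Fin n → ℝ) → ℝ :=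
  fun x => eval x (homogeneousComponent p.totalDegree p)

/-- Evaluation of a polynomial, as a function `ℝⁿ → ℝ`. -/
noncomputable def evalFn {n : ℕ} (p : MvPolynomial (Fin n) ℝ) : (Fin n → ℝ) → ℝ :=
  fun x => eval x p

/-- `⟨∇p^∞(x), y⟩`: the inner product of the gradient of the recession polynomial
of `p` at `x` with `y`. -/
noncomputable def gradRecInner {n : ℕ} (p : MvPolynomial (Fin n) ℝ) (x y : Fin n → ℝ) : ℝ :=
  ∑ j, (eval x (pderiv j (homogeneousComponent p.totalDegree p))) * y j

/-- `x` is a solution of the weak vector complementarity problem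
`WVCP(C, ∇f^∞)`. -/
def isWVCPsol {n s : ℕ} (C : Set (Fin n → ℝ)) (f : Fin s → MvPolynomial (Fin n) ℝ)
    (x : Fin n → ℝ) : Prop :=
  x ∈ C ∧ (∀ y ∈ C, ¬ (∀ i, gradRecInner (f i) x y < 0)) ∧
    ¬ (∀ i, 0 < gradRecInner (f i) x x)

lemma asymp_smul {n : ℕ} {K : Set (Fin n → ℝ)} {v : Fin n → ℝ} (hv : v ∈ asympCone K)
    {c : ℝ} (hc : 0 < c) : c • v ∈ asympCone K := by
  obtain ⟨t, x, hx, ht, hl⟩ := hv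
  refine ⟨fun k => c⁻¹ * t k, x, hx, ht.const_mul_atTop (inv_pos.mpr hc), ?_⟩
  refine (hl.const_smul c).congr fun k => ?_
  rw [mul_inv, inv_inv, smul_smul]

lemma asymp_of_approx {n : ℕ} {K : Set (Fin n → ℝ)} {v : Fin n → ℝ}
    (H : ∀ k : ℕ, ∃ t : ℝ, ∃ x ∈ K, (k : ℝ) ≤ t ∧ dist (t⁻¹ • x) v < 1 / ((k : ℝ) + 1)) :
    v ∈ asympCone K := by
  choose t x hx ht hd using H
  refine ⟨t, x, hx, tendsto_atTop_mono ht tendsto_natCast_atTop_atTop, ?_⟩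
  rw [tendsto_iff_dist_tendsto_zero]
  exact squeeze_zero (fun _ => dist_nonneg) (fun k => (hd k).le)
    tendsto_one_div_add_atTop_nhds_zero_nat

lemma asymp_closed {n : ℕ} (K : Set (Fin n → ℝ)) : IsClosed (asympCone K) := by
  rw [← closure_subset_iff_isClosed]
  intro v hv
  apply asymp_of_approx
  intro k
  have hk : (0 : ℝ) < 1 / ((k : ℝ) + 1) := by positivity
  obtain ⟨w, ⟨t, x, hx, ht, hl⟩, hw⟩ := Metric.mem_closure_iff.mp hv _ (half_pos hk)
  have h1 := (Metric.tendsto_nhds.mp hl) _ (half_pos hk)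
  obtain ⟨j, hj1, hj2⟩ := (h1.and (ht.eventually_ge_atTop (k : ℝ))).exists
  refine ⟨t j, x j, hx j, hj2, ?_⟩
  have := dist_triangle ((t j)⁻¹ • x j) w v
  rw [dist_comm v w] at hw
  linarith

lemma asymp_asymp {n : ℕ} (K : Set (Fin n → ℝ)) : asympCone (asympCone K) ⊆ asympCone K := by
  rintro v ⟨t, x, hx, ht, hl⟩
  refine (asymp_closed K).mem_of_tendsto hl ?_
  filter_upwards [ht.eventually_gt_atTop 0] with k hk
  exact asymp_smul (hx k) (inv_pos.mpr hk)

lemma eval_smul_hom {n : ℕ} {p : MvPolynomial (Fin n) ℝ} {d : ℕ} (hp : p.IsHomogeneous d)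
    (c : ℝ) (x : Fin n → ℝ) : eval (c • x) p = c ^ d * eval x p := by
  rw [eval_eq, eval_eq, Finset.mul_sum]
  refine Finset.sum_congr rfl fun m hm => ?_
  have hd : ∑ i ∈ m.support, m i = d := by
    have := hp (mem_support_iff.mp hm)
    rwa [Finsupp.weight_apply, Finsupp.sum, Finset.sum_congr rfl
      (fun i _ => by simp : ∀ i ∈ m.support, m i • (1 : Fin n → ℕ) i = m i)] at this
  simp only [Pi.smul_apply, smul_eq_mul, mul_pow, Finset.prod_mul_distrib]
  rw [Finset.prod_pow_eq_pow_sum, hd]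
  ring

lemma eval_asymp {n : ℕ} (p : MvPolynomial (Fin n) ℝ) (d : ℕ) (hd : p.totalDegree ≤ d)
    (t : ℕ → ℝ) (x : ℕ → Fin n → ℝ) (v : Fin n → ℝ) (ht : Tendsto t atTop atTop)
    (hl : Tendsto (fun k => (t k)⁻¹ • x k) atTop (𝓝 v)) :
    Tendsto (fun k => eval (x k) p / t k ^ d) atTop (𝓝 (eval v (homogeneousComponent d p))) := by
  have hsum : ∑ j ∈ Finset.range (d + 1), homogeneousComponent j p = p := by
    conv_rhs => rw [← sum_homogeneousComponent p]
    symm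
    apply Finset.sum_subset
    · intro j; simp only [Finset.mem_range]; omega
    · intro j _ hj
      apply homogeneousComponent_eq_zero
      simp only [Finset.mem_range] at hj; omega
  have hterm : ∀ j ∈ Finset.range d, Tendsto (fun k => eval ((t k)⁻¹ • x k)
      (homogeneousComponent j p) * (t k ^ (d - j))⁻¹) atTop (𝓝 0) := by
    intro j hj
    have h1 : Tendsto (fun k => eval ((t k)⁻¹ • x k) (homogeneousComponent j p)) atTop
        (𝓝 (eval v (homogeneousComponent j p))) :=
      ((MvPolynomial.continuous_eval _).tendsto v).comp hl
    have h2 : Tendsto (fun k => (t k ^ (d - j))⁻¹) atTop (𝓝 0) := by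
      apply Tendsto.inv_tendsto_atTop
      refine (tendsto_pow_atTop ?_).comp ht
      have := Finset.mem_range.mp hj; omega
    simpa using h1.mul h2
  have h1 : Tendsto (fun k => eval ((t k)⁻¹ • x k) (homogeneousComponent d p)) atTop
        (𝓝 (eval v (homogeneousComponent d p))) :=
      ((MvPolynomial.continuous_eval _).tendsto v).comp hl
  have h2 := (tendsto_finsetSum _ hterm).add h1
  simp only [Finset.sum_const_zero, zero_add] at h2
  refine h2.congr' ?_
  filter_upwards [ht.eventually_gt_atTop 0] with k hk
  have hx : x k = t k • ((t k)⁻¹ • x k) := by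
    rw [smul_smul, mul_inv_cancel₀ hk.ne', one_smul]
  generalize hy : (t k)⁻¹ • x k = y at *
  rw [hx]
  conv_rhs => rw [← hsum]
  rw [map_sum, Finset.sum_range_succ, add_div, Finset.sum_div]
  congr 1
  · refine Finset.sum_congr rfl fun j hj => ?_
    rw [eval_smul_hom (homogeneousComponent_isHomogeneous j p)]
    have : t k ^ d = t k ^ j * t k ^ (d - j) := by
      rw [← pow_add]; congr 1; have := Finset.mem_range.mp hj; omega
    rw [this]
    field_simp
  · rw [eval_smul_hom (homogeneousComponent_isHomogeneous d p)]
    field_simp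

lemma bdd_sublevel {n : ℕ} {ι : Type*} (K : Set (Fin n → ℝ)) (f : ι → MvPolynomial (Fin n) ℝ)
    (d : ι → ℕ) (hd : ∀ i, (f i).totalDegree ≤ d i) (hd1 : ∀ i, 1 ≤ d i) (M : ι → ℝ)
    (H : ∀ v ∈ asympCone K, v ≠ 0 → ∃ i, 0 < eval v (homogeneousComponent (d i) (f i))) :
    Bornology.IsBounded {x | x ∈ K ∧ ∀ i, eval x (f i) ≤ M i} := by
  by_contra hb
  have hex : ∀ k : ℕ, ∃ x, (x ∈ K ∧ ∀ i, eval x (f i) ≤ M i) ∧ (k : ℝ) < ‖x‖ := by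
    intro k
    by_contra hcon
    push Not at hcon
    exact hb (isBounded_iff_forall_norm_le.mpr ⟨k, fun x hx => hcon x hx⟩)
  choose x hx hxn using hex
  have hpos : ∀ k, 0 < ‖x k‖ := fun k => lt_of_le_of_lt (Nat.cast_nonneg k) (hxn k)
  have hS : ∀ k, (‖x k‖)⁻¹ • x k ∈ Metric.sphere (0 : Fin n → ℝ) 1 := by
    intro k
    rw [mem_sphere_zero_iff_norm, norm_smul, norm_inv, norm_norm, inv_mul_cancel₀ (hpos k).ne']
  obtain ⟨v, hv, φ, hφ, hl⟩ := (isCompact_sphere (0 : Fin n → ℝ) 1).tendsto_subseq hS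
  have ht : Tendsto (fun k => ‖x (φ k)‖) atTop atTop :=
    (tendsto_atTop_mono (fun k => (hxn k).le) tendsto_natCast_atTop_atTop).comp hφ.tendsto_atTop
  have hv0 : v ≠ 0 := by
    rintro rfl
    simp at hv
  obtain ⟨i, hi⟩ := H v ⟨_, fun k => x (φ k), fun k => (hx _).1, ht, hl⟩ hv0
  have h1 := eval_asymp (f i) (d i) (hd i) _ (fun k => x (φ k)) v ht hl
  have h2 : Tendsto (fun k => M i / ‖x (φ k)‖ ^ d i) atTop (𝓝 0) :=
    Tendsto.const_div_atTop ((tendsto_pow_atTop (by have := hd1 i; omega)).comp ht) _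
  have := le_of_tendsto_of_tendsto' h1 h2 fun k => by
    have := (hx (φ k)).2 i
    gcongr
  linarith

lemma rec_pos {n s : ℕ} (K : Set (Fin n → ℝ))
    (f : Fin s → MvPolynomial (Fin n) ℝ) (hdeg : ∀ i, 1 ≤ (f i).totalDegree)
    (h : SOLw (asympCone K) (fun i => recFn (f i)) = {0}) (v : Fin n → ℝ)
    (hv : v ∈ asympCone K) (hv0 : v ≠ 0) (i : Fin s) : 0 < recFn (f i) v := by
  have hz : ∀ j, recFn (f j) 0 = 0 := by
    intro j
    have := eval_smul_hom (homogeneousComponent_isHomogeneous (f j).totalDegree (f j)) 0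
      (0 : Fin n → ℝ)
    rw [zero_smul, zero_pow (by have := hdeg j; omega), zero_mul] at this
    exact this
  have h0 : (0 : Fin n → ℝ) ∈ SOLw (asympCone K) (fun i => recFn (f i)) := by rw [h]; rfl
  have hnot : ∀ v ∈ asympCone K, v ≠ 0 → ∃ w ∈ asympCone K, ∀ i, recFn (f i) w < recFn (f i) v := by
    intro v hv hv0
    by_contra hcon
    push Not at hcon
    have : v ∈ SOLw (asympCone K) (fun i => recFn (f i)) := by
      refine ⟨hv, fun y hy hlt => ?_⟩
      obtain ⟨i, hi⟩ := hcon y hy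
      exact absurd (hlt i) (not_lt.mpr hi)
    rw [h] at this
    exact hv0 this
  have hmax : ∀ v ∈ asympCone K, v ≠ 0 → ∃ i, 0 < recFn (f i) v := by
    intro v hv hv0
    by_contra hcon
    push Not at hcon
    obtain ⟨w, hw, hlt⟩ := hnot v hv hv0
    refine h0.2 w hw fun i => ?_
    have := hlt i
    have := hcon i
    simp only [hz]
    linarith
  by_contra hneg
  push Not at hneg
  obtain ⟨w, hw, hlt⟩ := hnot v hv hv0
  have hcont : ∀ j, Continuous (recFn (f j)) := fun j => MvPolynomial.continuous_eval _
  set B := {x | x ∈ asympCone K ∧ ∀ j, recFn (f j) x ≤ recFn (f j) w} with hB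
  have hBb : Bornology.IsBounded B := by
    refine bdd_sublevel (asympCone K)
      (fun j => homogeneousComponent (f j).totalDegree (f j)) (fun j => (f j).totalDegree)
      (fun j => (homogeneousComponent_isHomogeneous _ _).totalDegree_le) hdeg
      (fun j => recFn (f j) w) ?_
    intro u hu hu0
    obtain ⟨j, hj⟩ := hmax u (asymp_asymp K hu) hu0
    refine ⟨j, ?_⟩
    rw [homogeneousComponent_of_mem (homogeneousComponent_mem _ _), if_pos rfl]
    exact hj
  have hBc : IsClosed B := by
    have : B = asympCone K ∩ ⋂ j, {x | recFn (f j) x ≤ recFn (f j) w} := by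
      ext; simp [hB]
    rw [this]
    exact (asymp_closed K).inter (isClosed_iInter fun j => isClosed_le (hcont j) continuous_const)
  obtain ⟨u, hu, hmin⟩ := (Metric.isCompact_of_isClosed_isBounded hBc hBb).exists_isMinOn
    ⟨w, hw, fun _ => le_rfl⟩ (hcont i).continuousOn
  have hu0 : u ≠ 0 := by
    rintro rfl
    have h1 := hu.2 i
    have h2 := hlt i
    rw [hz] at h1
    linarith
  obtain ⟨y, hy, hyl⟩ := hnot u hu.1 hu0
  have := hmin (show y ∈ B from ⟨hy, fun j => (hyl j).le.trans (hu.2 j)⟩)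
  exact absurd (hyl i) (not_lt.mpr this)

theorem stmt14 {n s : ℕ} (hs : 0 < s) (K : Set (Fin n → ℝ)) (hK : K.Nonempty) (hKc : IsClosed K)
    (f : Fin s → MvPolynomial (Fin n) ℝ) (hdeg : ∀ i, 1 ≤ (f i).totalDegree)
    (h : SOLw (asympCone K) (fun i => recFn (f i)) = {0}) :
    (SOLs K (fun i => evalFn (f i))).Nonempty ∧ IsCompact (SOLw K (fun i => evalFn (f i))) := by
  have hcont : ∀ j, Continuous (evalFn (f j)) := fun j => MvPolynomial.continuous_eval _
  obtain ⟨x0, hx0⟩ := hK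
  have hbd : ∀ i, Bornology.IsBounded {x | x ∈ K ∧ evalFn (f i) x ≤ evalFn (f i) x0} := by
    intro i
    have := bdd_sublevel (ι := Unit) K (fun _ => f i) (fun _ => (f i).totalDegree)
      (fun _ => le_rfl) (fun _ => hdeg i) (fun _ => evalFn (f i) x0)
      (fun v hv hv0 => ⟨(), rec_pos K f hdeg h v hv hv0 i⟩)
    simpa [evalFn] using this
  constructor
  · set B := {x | x ∈ K ∧ ∀ j, evalFn (f j) x ≤ evalFn (f j) x0} with hB
    have hBb : Bornology.IsBounded B := (hbd ⟨0, hs⟩).subset fun x hx => ⟨hx.1, hx.2 _⟩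
    have hBc : IsClosed B := by
      have : B = K ∩ ⋂ j, {x | evalFn (f j) x ≤ evalFn (f j) x0} := by
        ext; simp [hB]
      rw [this]
      exact hKc.inter (isClosed_iInter fun j => isClosed_le (hcont j) continuous_const)
    obtain ⟨u, hu, hmin⟩ := (Metric.isCompact_of_isClosed_isBounded hBc hBb).exists_isMinOn
      ⟨x0, hx0, fun _ => le_rfl⟩
      (f := fun x => ∑ j, evalFn (f j) x) (continuous_finsetSum _ fun j _ => hcont j).continuousOn
    refine ⟨u, hu.1, ?_⟩
    rintro y hy ⟨hle, i, hi⟩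
    have h1 : ∑ j, evalFn (f j) u ≤ ∑ j, evalFn (f j) y :=
      hmin (show y ∈ B from ⟨hy, fun j => (hle j).trans (hu.2 j)⟩)
    have h2 : ∑ j, evalFn (f j) y < ∑ j, evalFn (f j) u :=
      Finset.sum_lt_sum (fun j _ => hle j) ⟨i, Finset.mem_univ i, hi⟩
    linarith
  · apply Metric.isCompact_of_isClosed_isBounded
    · have : SOLw K (fun i => evalFn (f i)) =
          K ∩ ⋂ y ∈ K, ⋃ i, {x | evalFn (f i) x ≤ evalFn (f i) y} := by
        ext; simp [SOLw]
      rw [this]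
      exact hKc.inter (isClosed_biInter fun y _ => isClosed_iUnion_of_finite fun i =>
        isClosed_le (hcont i) continuous_const)
    · refine ((Bornology.isBounded_iUnion).mpr hbd).subset ?_
      rintro x ⟨hx, hx2⟩
      have := hx2 x0 hx0
      push Not at this
      obtain ⟨i, hi⟩ := this
      exact Set.mem_iUnion.mpr ⟨i, hx, hi⟩
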